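/- arXiv:2309.04476 — 4 statements merged into one kernel-verified Lean document; each statement's English description precedes it below -/
import Mathlib

section
/- Let a triangle have vertices A, B, C on the Eisenstein lattice (points m + nω with m, n ∈ ℤ, ω = -1/2 + i·√3/2), with A, B, C not collinear, and suppose the triangle is equable (its area equals its perimeter). Then each of the three side lengths is of the form √3·n for some positive integer n. -/
open Complex

/-- The Eisenstein cube root of unity `ω = -1/2 + i·√3/2`. -/
noncomputable def eisensteinOmega : ℂ := -1/2 + Complex.I * (Real.sqrt 3 / 2)

/-- Membership in the Eisenstein lattice: points of the form `m + n·ω` with `m, n ∈ ℤ`. -/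
def IsEisenstein (z : ℂ) : Prop := ∃ m n : ℤ, z = (m : ℂ) + (n : ℂ) * eisensteinOmega

/-- If three positive real square roots have a rational sum, the last of them is an integer. -/
theorem isSquare_of_sqrt_add_sqrt_add_sqrt_eq_ratCast {x y z : ℕ} (hx : 0 < x) (hy : 0 < y)
    (hz : 0 < z) {q : ℚ} (h : √(x : ℝ) + √(y : ℝ) + √(z : ℝ) = q) : IsSquare z := by
  by_contra hsq
  have hirr : Irrational √(z : ℝ) := irrational_sqrt_natCast_iff.mpr hsq
  have hx' : 0 < √(x : ℝ) := Real.sqrt_pos.mpr (by exact_mod_cast hx)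
  have hy' : 0 < √(y : ℝ) := Real.sqrt_pos.mpr (by exact_mod_cast hy)
  have hz' : 0 < √(z : ℝ) := Real.sqrt_pos.mpr (by exact_mod_cast hz)
  have hx2 : √(x : ℝ) ^ 2 = x := Real.sq_sqrt (Nat.cast_nonneg x)
  have hy2 : √(y : ℝ) ^ 2 = y := Real.sq_sqrt (Nat.cast_nonneg y)
  have hz2 : √(z : ℝ) ^ 2 = z := Real.sq_sqrt (Nat.cast_nonneg z)
  have hq : (0 : ℝ) < q := h ▸ by positivity
  obtain ⟨r, hr⟩ : ∃ r : ℚ, r = (q ^ 2 + z - x - y) / 2 := ⟨_, rfl⟩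
  have hrR : (r : ℝ) = (q ^ 2 + z - x - y) / 2 := by rw [hr]; push_cast; rfl
  have hprod : √(x : ℝ) * √(y : ℝ) = r - q * √(z : ℝ) := by
    rw [hrR, ← h]
    linear_combination (-1 / 2 : ℝ) * hx2 - (1 / 2 : ℝ) * hy2 + (1 / 2 : ℝ) * hz2
  have hr0 : (0 : ℝ) < r := by
    have : (r : ℝ) = √(x : ℝ) * √(y : ℝ) + q * √(z : ℝ) := by linarith
    rw [this]
    positivity
  refine hirr ⟨(r ^ 2 + q ^ 2 * z - x * y) / (2 * r * q), ?_⟩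
  push_cast
  rw [div_eq_iff (by positivity)]
  have hsquare : (x : ℝ) * y = (r - q * √(z : ℝ)) ^ 2 := by
    rw [← hprod, mul_pow, hx2, hy2]
  linear_combination -hsquare - (q : ℝ) ^ 2 * hz2

/-- If three positive real square roots add up to a rational multiple of `√3`, the last of them
is an integer multiple of `√3`. -/
theorem exists_sqrt_eq_sqrt_three_mul {x y z : ℕ} (hx : 0 < x) (hy : 0 < y) (hz : 0 < z) {q : ℚ}
    (h : √(x : ℝ) + √(y : ℝ) + √(z : ℝ) = √3 * q) :
    ∃ n : ℕ, 0 < n ∧ √(z : ℝ) = √3 * n := by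
  have hmul (m : ℕ) : √((3 * m : ℕ) : ℝ) = √3 * √(m : ℝ) := by
    push_cast
    exact Real.sqrt_mul (by norm_num) _
  have h3 : √(3 : ℝ) ^ 2 = 3 := Real.sq_sqrt (by norm_num)
  obtain ⟨m, hm⟩ : IsSquare (3 * z) := by
    refine isSquare_of_sqrt_add_sqrt_add_sqrt_eq_ratCast (x := 3 * x) (y := 3 * y) (q := 3 * q)
      (by positivity) (by positivity) (by positivity) ?_
    simp only [hmul]
    push_cast
    linear_combination √3 * h + (q : ℝ) * h3
  obtain ⟨n, rfl⟩ : 3 ∣ m := (Nat.prime_three.dvd_mul.mp ⟨z, hm.symm⟩).elim id id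
  have hzn : z = 3 * n ^ 2 := by linarith
  refine ⟨n, Nat.pos_of_ne_zero fun hn => ?_, ?_⟩
  · simp [hn] at hzn
    omega
  · rw [hzn, hmul]
    push_cast
    rw [Real.sqrt_sq (Nat.cast_nonneg n)]

theorem IsEisenstein.sub {z w : ℂ} (hz : IsEisenstein z) (hw : IsEisenstein w) :
    IsEisenstein (z - w) := by
  obtain ⟨a, b, rfl⟩ := hz
  obtain ⟨c, d, rfl⟩ := hw
  exact ⟨a - c, b - d, by push_cast; ring⟩

theorem eisenstein_re (m n : ℤ) : ((m : ℂ) + n * eisensteinOmega).re = m - n / 2 := by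
  simp [eisensteinOmega]
  ring

theorem eisenstein_im (m n : ℤ) : ((m : ℂ) + n * eisensteinOmega).im = n * √3 / 2 := by
  simp [eisensteinOmega]
  ring

theorem IsEisenstein.exists_norm_eq_sqrt {z : ℂ} (hz : IsEisenstein z) :
    ∃ N : ℕ, ‖z‖ = √(N : ℝ) := by
  obtain ⟨m, n, rfl⟩ := hz
  have h3 : √(3 : ℝ) ^ 2 = 3 := Real.sq_sqrt (by norm_num)
  have hnonneg : 0 ≤ m ^ 2 - m * n + n ^ 2 := by nlinarith [sq_nonneg (m - n), sq_nonneg (m + n)]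
  obtain ⟨N, hN⟩ := Int.eq_ofNat_of_zero_le hnonneg
  have hNR : (m : ℝ) ^ 2 - m * n + n ^ 2 = N := by exact_mod_cast hN
  refine ⟨N, ?_⟩
  rw [Complex.norm_def, Complex.normSq_apply, eisenstein_re, eisenstein_im, ← hNR]
  congr 1
  linear_combination (n : ℝ) ^ 2 / 4 * h3

theorem IsEisenstein.exists_dist_eq_sqrt {z w : ℂ} (hz : IsEisenstein z) (hw : IsEisenstein w)
    (hne : z ≠ w) : ∃ N : ℕ, 0 < N ∧ dist z w = √(N : ℝ) := by
  obtain ⟨N, hN⟩ := (hz.sub hw).exists_norm_eq_sqrt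
  have hpos : 0 < √(N : ℝ) := hN ▸ norm_pos_iff.mpr (sub_ne_zero.mpr hne)
  exact ⟨N, by exact_mod_cast Real.sqrt_pos.mp hpos, by rw [dist_eq_norm, hN]⟩

theorem IsEisenstein.exists_half_abs_im_mul_conj {z w : ℂ} (hz : IsEisenstein z)
    (hw : IsEisenstein w) :
    ∃ q : ℚ, (1 / 2) * |(z * (starRingEnd ℂ) w).im| = √3 * q := by
  obtain ⟨a, b, rfl⟩ := hz
  obtain ⟨c, d, rfl⟩ := hw
  refine ⟨|b * c - a * d| / 4, ?_⟩
  have him : (((a : ℂ) + b * eisensteinOmega) *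
      (starRingEnd ℂ) ((c : ℂ) + d * eisensteinOmega)).im = √3 / 2 * (b * c - a * d) := by
    rw [Complex.mul_im, Complex.conj_re, Complex.conj_im]
    simp only [eisenstein_re, eisenstein_im]
    ring
  rw [him, abs_mul, abs_of_nonneg (by positivity : 0 ≤ √3 / 2)]
  push_cast
  ring

theorem equable_eisenstein_sides_sqrt3_mul_int
    (A B C : ℂ) (hA : IsEisenstein A) (hB : IsEisenstein B) (hC : IsEisenstein C)
    (hncol : ¬ Collinear ℝ ({A, B, C} : Set ℂ))
    (hequable : (1/2) * |((B - A) * (starRingEnd ℂ) (C - A)).im| =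
      dist A B + dist B C + dist C A) :
    (∃ n : ℕ, 0 < n ∧ dist A B = Real.sqrt 3 * n) ∧
    (∃ n : ℕ, 0 < n ∧ dist B C = Real.sqrt 3 * n) ∧
    (∃ n : ℕ, 0 < n ∧ dist C A = Real.sqrt 3 * n) := by
  have hAB : A ≠ B := by
    rintro rfl
    exact hncol (by simpa using collinear_pair ℝ A C)
  have hBC : B ≠ C := by
    rintro rfl
    exact hncol (by simpa using collinear_pair ℝ A B)
  have hCA : C ≠ A := by
    rintro rfl
    exact hncol (by simpa [Set.pair_comm] using collinear_pair ℝ C B)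
  obtain ⟨x, hx, hxd⟩ := hA.exists_dist_eq_sqrt hB hAB
  obtain ⟨y, hy, hyd⟩ := hB.exists_dist_eq_sqrt hC hBC
  obtain ⟨z, hz, hzd⟩ := hC.exists_dist_eq_sqrt hA hCA
  obtain ⟨q, hq⟩ := (hB.sub hA).exists_half_abs_im_mul_conj (hC.sub hA)
  rw [hq, hxd, hyd, hzd] at hequable
  rw [hxd, hyd, hzd]
  exact ⟨exists_sqrt_eq_sqrt_three_mul hy hz hx (q := q) (by linarith),
    exists_sqrt_eq_sqrt_three_mul hz hx hy (q := q) (by linarith),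
    exists_sqrt_eq_sqrt_three_mul hx hy hz (q := q) (by linarith)⟩
end

section
/- The only triples (x, y, z) of positive integers with x ≤ y ≤ z satisfying 3xyz = 4(x + y + z) are (x, y, z) = (1, 2, 6) and (x, y, z) = (2, 2, 2). -/
theorem equable_diophantine_solutions (x y z : ℕ)
    (hx : 0 < x) (hy : 0 < y) (hz : 0 < z)
    (hxy : x ≤ y) (hyz : y ≤ z) :
    3 * x * y * z = 4 * (x + y + z) ↔ (x, y, z) = (1, 2, 6) ∨ (x, y, z) = (2, 2, 2) := by
  simp only [Prod.mk.injEq]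
  constructor
  · intro h
    have hmul : x * y ≤ 4 := by
      refine Nat.le_of_mul_le_mul_right (c := 3 * z) ?_ (by omega)
      calc x * y * (3 * z) = 3 * x * y * z := by ring
        _ = 4 * (x + y + z) := h
        _ ≤ 4 * (3 * z) := by omega
    have hx2 : x ≤ 2 := by nlinarith
    have hy4 : y ≤ 4 := by nlinarith
    interval_cases x <;> interval_cases y <;> omega
  · rintro (⟨rfl, rfl, rfl⟩ | ⟨rfl, rfl, rfl⟩) <;> norm_num
end

section
/- Let a, b, c be positive real numbers, each of the form √3·n for some positive integer n, satisfying the strict triangle inequalities (-a+b+c > 0, a-b+c > 0, a+b-c > 0) and the equable condition (a+b+c)(-a+b+c)(a-b+c)(a+b-c) = 16(a+b+c)². Then the multiset {a, b, c} equals {4√3, 4√3, 4√3} or {3√3, 7√3, 8√3}. -/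
/-- The ordered solutions of `3uvw = 4(u + v + w)` in positive integers. -/
theorem eq_of_three_mul_eq_four_mul_add {u v w : ℤ} (hu : 0 < u) (huv : u ≤ v) (hvw : v ≤ w)
    (h : 3 * (u * v * w) = 4 * (u + v + w)) :
    (u = 2 ∧ v = 2 ∧ w = 2) ∨ (u = 1 ∧ v = 2 ∧ w = 6) := by
  have huv4 : u * v ≤ 4 := by
    by_contra! hlt
    nlinarith
  have hu2 : u ≤ 2 := by nlinarith
  have hv4 : v ≤ 4 := by nlinarith
  have hv : 0 < v := by lia
  interval_cases u <;> interval_cases v <;> lia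

/-- Integer sides, in increasing order, of the triangles that are equable after scaling by `√3`. -/
theorem ordered_sides_of_equable {l m n : ℤ} (hlm : l ≤ m) (hmn : m ≤ n) (hn : n < l + m)
    (h : 3 * ((-l + m + n) * (l - m + n) * (l + m - n)) = 16 * (l + m + n)) :
    (l = 4 ∧ m = 4 ∧ n = 4) ∨ (l = 3 ∧ m = 7 ∧ n = 8) := by
  have heven : Even (l + m - n) := by
    have h2 : Even (3 * ((-l + m + n) * (l - m + n) * (l + m - n))) := by
      rw [h]
      exact ⟨8 * (l + m + n), by ring⟩
    simp only [Int.even_mul, Int.even_add, Int.even_sub, even_neg] at h2 ⊢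
    have h3 : ¬ Even (3 : ℤ) := by decide
    tauto
  obtain ⟨u, hu⟩ := heven
  obtain rfl : n = l + m - 2 * u := by lia
  have key : 3 * (u * (l - u) * (m - u)) = 4 * (u + (l - u) + (m - u)) := by linarith
  have := eq_of_three_mul_eq_four_mul_add (by lia) (by lia) (by lia) key
  lia

/-- Integer sides of the triangles that are equable after scaling by `√3`. -/
theorem sides_of_equable {l m n : ℕ} (h1 : l < m + n) (h2 : m < l + n) (h3 : n < l + m)
    (h : 3 * ((-l + m + n : ℤ) * (l - m + n) * (l + m - n)) = 16 * (l + m + n)) :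
    ({l, m, n} : Multiset ℕ) = {4, 4, 4} ∨ ({l, m, n} : Multiset ℕ) = {3, 7, 8} := by
  have solve {x y z : ℕ} (hxy : x ≤ y) (hyz : y ≤ z) (hz : z < x + y)
      (hxyz : 3 * ((-x + y + z : ℤ) * (x - y + z) * (x + y - z)) = 16 * (x + y + z)) :
      (x = 4 ∧ y = 4 ∧ z = 4) ∨ (x = 3 ∧ y = 7 ∧ z = 8) := by
    have := ordered_sides_of_equable (l := x) (m := y) (n := z) (by lia) (by lia) (by lia) hxyz
    lia
  rcases le_total l m with hlm | hlm <;> rcases le_total m n with hmn | hmn <;>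
    rcases le_total l n with hln | hln
  · rcases solve hlm hmn h3 h with ⟨rfl, rfl, rfl⟩ | ⟨rfl, rfl, rfl⟩ <;> decide
  · rcases solve hlm hmn h3 h with ⟨rfl, rfl, rfl⟩ | ⟨rfl, rfl, rfl⟩ <;> decide
  · rcases solve hln hmn (by lia) (by linarith) with ⟨rfl, rfl, rfl⟩ | ⟨rfl, rfl, rfl⟩ <;> decide
  · rcases solve hln hlm (by lia) (by linarith) with ⟨rfl, rfl, rfl⟩ | ⟨rfl, rfl, rfl⟩ <;> decide
  · rcases solve hlm hln (by lia) (by linarith) with ⟨rfl, rfl, rfl⟩ | ⟨rfl, rfl, rfl⟩ <;> decide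
  · rcases solve hmn hln (by lia) (by linarith) with ⟨rfl, rfl, rfl⟩ | ⟨rfl, rfl, rfl⟩ <;> decide
  · rcases solve hmn hlm (by lia) (by linarith) with ⟨rfl, rfl, rfl⟩ | ⟨rfl, rfl, rfl⟩ <;> decide
  · rcases solve hmn hlm (by lia) (by linarith) with ⟨rfl, rfl, rfl⟩ | ⟨rfl, rfl, rfl⟩ <;> decide

theorem equable_sqrt3_sides_classification (a b c : ℝ)
    (ha : ∃ n : ℕ, 0 < n ∧ a = Real.sqrt 3 * n)
    (hb : ∃ n : ℕ, 0 < n ∧ b = Real.sqrt 3 * n)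
    (hc : ∃ n : ℕ, 0 < n ∧ c = Real.sqrt 3 * n)
    (h1 : 0 < -a + b + c) (h2 : 0 < a - b + c) (h3 : 0 < a + b - c)
    (hequable : (a + b + c) * (-a + b + c) * (a - b + c) * (a + b - c) =
      16 * (a + b + c) ^ 2) :
    ({a, b, c} : Multiset ℝ) = {4 * Real.sqrt 3, 4 * Real.sqrt 3, 4 * Real.sqrt 3} ∨
    ({a, b, c} : Multiset ℝ) = {3 * Real.sqrt 3, 7 * Real.sqrt 3, 8 * Real.sqrt 3} := by
  obtain ⟨l, hl, rfl⟩ := ha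
  obtain ⟨m, -, rfl⟩ := hb
  obtain ⟨n, -, rfl⟩ := hc
  have hs : (0 : ℝ) < √3 := by positivity
  have hsq : √3 ^ 2 = (3 : ℝ) := Real.sq_sqrt (by norm_num)
  have hl' : (0 : ℝ) < l := by exact_mod_cast hl
  have t1 : (l : ℝ) < m + n := by nlinarith
  have t2 : (m : ℝ) < l + n := by nlinarith
  have t3 : (n : ℝ) < l + m := by nlinarith
  have heq : 3 * ((-l + m + n : ℝ) * (l - m + n) * (l + m - n)) = 16 * (l + m + n) := by
    have hne : (√3 ^ 2 * (l + m + n) : ℝ) ≠ 0 := by positivity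
    apply mul_left_cancel₀ hne
    linear_combination hequable -
      √3 ^ 2 * (l + m + n) * ((-l + m + n) * (l - m + n) * (l + m - n)) * hsq
  have hmap := sides_of_equable (l := l) (m := m) (n := n) (by exact_mod_cast t1)
    (by exact_mod_cast t2) (by exact_mod_cast t3) (by exact_mod_cast heq)
  refine hmap.imp (fun h => ?_) fun h => ?_ <;>
    simpa [mul_comm] using congrArg (Multiset.map fun k : ℕ => √3 * (k : ℝ)) h
end

section
/- Let a, b, c be positive reals satisfying the strict triangle inequalities, with each of a, b, c of the form √3·n for a positive integer n, and suppose the triangle with sides a, b, c has area equal to perimeter. Setting u = (-a+b+c)/√3, v = (a-b+c)/√3, w = (a+b-c)/√3, the numbers u, v, w are positive integers of the same parity satisfying 3uvw = 16(u + v + w), and a = √3(v+w)/2, b = √3(u+w)/2, c = √3(u+v)/2. -/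
theorem equable_sqrt3_sides_to_diophantine (a b c : ℝ)
    (ha : ∃ n : ℕ, 0 < n ∧ a = Real.sqrt 3 * n)
    (hb : ∃ n : ℕ, 0 < n ∧ b = Real.sqrt 3 * n)
    (hc : ∃ n : ℕ, 0 < n ∧ c = Real.sqrt 3 * n)
    (h1 : 0 < -a + b + c) (h2 : 0 < a - b + c) (h3 : 0 < a + b - c)
    (hequable : (1/4) * Real.sqrt ((a + b + c) * (-a + b + c) * (a - b + c) * (a + b - c)) =
      a + b + c) :
    ∃ u v w : ℕ, 0 < u ∧ 0 < v ∧ 0 < w ∧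
      ((-a + b + c) / Real.sqrt 3 = u) ∧
      ((a - b + c) / Real.sqrt 3 = v) ∧
      ((a + b - c) / Real.sqrt 3 = w) ∧
      u % 2 = v % 2 ∧ v % 2 = w % 2 ∧
      3 * u * v * w = 16 * (u + v + w) ∧
      a = Real.sqrt 3 * (v + w) / 2 ∧
      b = Real.sqrt 3 * (u + w) / 2 ∧
      c = Real.sqrt 3 * (u + v) / 2 := by
  obtain ⟨l, -, rfl⟩ := ha
  obtain ⟨m, -, rfl⟩ := hb
  obtain ⟨n, -, rfl⟩ := hc
  have hs : 0 < Real.sqrt 3 := by positivity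
  have hs2 : Real.sqrt 3 ^ 2 = 3 := Real.sq_sqrt (by norm_num)
  have hl : l < m + n := by
    have h : (0 : ℝ) < -l + m + n := pos_of_mul_pos_right (by linarith) hs.le
    exact_mod_cast (by linarith : (l : ℝ) < m + n)
  have hm : m < l + n := by
    have h : (0 : ℝ) < l - m + n := pos_of_mul_pos_right (by linarith) hs.le
    exact_mod_cast (by linarith : (m : ℝ) < l + n)
  have hn : n < l + m := by
    have h : (0 : ℝ) < l + m - n := pos_of_mul_pos_right (by linarith) hs.le
    exact_mod_cast (by linarith : (n : ℝ) < l + m)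
  obtain ⟨u, hu⟩ := Nat.exists_eq_add_of_lt hl
  obtain ⟨v, hv⟩ := Nat.exists_eq_add_of_lt hm
  obtain ⟨w, hw⟩ := Nat.exists_eq_add_of_lt hn
  have hu' : (m + n : ℝ) = l + u + 1 := by exact_mod_cast hu
  have hv' : (l + n : ℝ) = m + v + 1 := by exact_mod_cast hv
  have hw' : (l + m : ℝ) = n + w + 1 := by exact_mod_cast hw
  have hlr : (l : ℝ) = (v + 1 + (w + 1)) / 2 := by linarith
  have hmr : (m : ℝ) = (u + 1 + (w + 1)) / 2 := by linarith
  have hnr : (n : ℝ) = (u + 1 + (v + 1)) / 2 := by linarith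
  have hd : (3 : ℝ) * (u + 1) * (v + 1) * (w + 1) = 16 * (u + 1 + (v + 1) + (w + 1)) := by
    have hsq := congrArg (· ^ 2) hequable
    simp only [mul_pow] at hsq
    rw [Real.sq_sqrt (by positivity), hlr, hmr, hnr] at hsq
    have hp : (0 : ℝ) < u + 1 + (v + 1) + (w + 1) := by positivity
    refine mul_left_cancel₀ hp.ne' ?_
    linear_combination (16 / 3) * hsq -
      ((u + 1 + (v + 1) + (w + 1)) * (u + 1) * (v + 1) * (w + 1) *
        (Real.sqrt 3 ^ 2 + 3) / 3 - (16 / 3) * (u + 1 + (v + 1) + (w + 1)) ^ 2) * hs2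
  refine ⟨u + 1, v + 1, w + 1, by omega, by omega, by omega, ?_, ?_, ?_, by omega, by omega,
    by exact_mod_cast hd, ?_, ?_, ?_⟩
  · push_cast
    field_simp
    linarith
  · push_cast
    field_simp
    linarith
  · push_cast
    field_simp
    linarith
  all_goals
    push_cast
    simp only [hlr, hmr, hnr]
    ring
end
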